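/- Let A_{-1}, A_0, A_1, G be as in the context, with G𝟙 = 𝟙, and let σ < 1 be a real number such that (A_{-1} − A_1)𝟙 ≥ (1 − σ)𝟙 entrywise. Then I − A_0 is invertible in B(ℓ∞) and, with H_1 := A_0 + A_1 + A_1G and H_2 := (I − A_0)^{-1}(A_1 + A_1G), one has ‖H_2‖ ≤ ‖H_1‖ ≤ σ. -/

import Mathlib

open BoundedContinuousFunction Filter

noncomputable section

/-- ℓ∞: the Banach space of bounded real sequences with the sup norm. -/
abbrev Linf : Type := BoundedContinuousFunction ℕ ℝ

/-- A sequence is nonnegative if all its entries are nonnegative. -/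
def vnonneg (x : Linf) : Prop := ∀ i, 0 ≤ x i

/-- An operator in B(ℓ∞) is positive if it maps nonnegative sequences to
nonnegative sequences. -/
def OpPos (A : Linf →L[ℝ] Linf) : Prop := ∀ x : Linf, vnonneg x → vnonneg (A x)

/-- The constant sequence with all entries equal to one. -/
def ones : Linf := BoundedContinuousFunction.const ℕ (1 : ℝ)

theorem OpPos.mono {A : Linf →L[ℝ] Linf} (hA : OpPos A) {x y : Linf} (h : ∀ i, x i ≤ y i) (i : ℕ) :
    A x i ≤ A y i := by
  have h1 := hA (y - x) (fun j => by simpa using h j) i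
  rw [map_sub] at h1
  simpa using h1

theorem OpPos.add {A B : Linf →L[ℝ] Linf} (hA : OpPos A) (hB : OpPos B) : OpPos (A + B) :=
  fun x hx i => add_nonneg (hA x hx i) (hB x hx i)

theorem OpPos.mul {A B : Linf →L[ℝ] Linf} (hA : OpPos A) (hB : OpPos B) : OpPos (A * B) :=
  fun x hx => hA _ (hB x hx)

theorem OpPos.pow {A : Linf →L[ℝ] Linf} (hA : OpPos A) : ∀ n : ℕ, OpPos (A ^ n)
  | 0 => fun x hx => by simpa using hx
  | n + 1 => by
    rw [pow_succ]
    exact (hA.pow n).mul hA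

theorem OpPos.tsum {A : ℕ → Linf →L[ℝ] Linf} (hA : ∀ n, OpPos (A n)) (hs : Summable A) :
    OpPos (∑' n, A n) := by
  intro x hx i
  have h := (hs.hasSum.mapL (ContinuousLinearMap.apply ℝ Linf x)).mapL
    (BoundedContinuousFunction.evalCLM ℝ i)
  exact h.nonneg fun n => hA n x hx i

theorem ones_apply (i : ℕ) : ones i = 1 := rfl

theorem vnonneg_ones : vnonneg ones := fun _ => zero_le_one

/-- The norm of a positive operator is controlled by its value at the constant sequence. -/
theorem OpPos.opNorm_le {A : Linf →L[ℝ] Linf} (hA : OpPos A) {c : ℝ}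
    (h : ∀ i, A ones i ≤ c) : ‖A‖ ≤ c := by
  have hc : 0 ≤ c := (hA ones vnonneg_ones 0).trans (h 0)
  refine A.opNorm_le_bound hc fun x => ?_
  refine (BoundedContinuousFunction.norm_le (by positivity)).2 fun i => ?_
  have hx (j : ℕ) : |x j| ≤ ‖x‖ := x.norm_coe_le_norm j
  have h1 := hA.mono (x := x) (y := ‖x‖ • ones)
    (fun j => by simpa [ones_apply] using (abs_le.1 (hx j)).2) i
  have h2 := hA.mono (x := -(‖x‖ • ones)) (y := x)
    (fun j => by simpa [ones_apply] using (abs_le.1 (hx j)).1) i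
  simp only [map_neg, map_smul, BoundedContinuousFunction.coe_neg, Pi.neg_apply,
    BoundedContinuousFunction.coe_smul, smul_eq_mul] at h1 h2
  have h3 := mul_le_mul_of_nonneg_left (h i) (norm_nonneg x)
  rw [Real.norm_eq_abs, abs_le]
  constructor <;> linarith

theorem apply_ones_le_opNorm (A : Linf →L[ℝ] Linf) (i : ℕ) : A ones i ≤ ‖A‖ := by
  have h1 : ‖ones‖ ≤ 1 := (BoundedContinuousFunction.norm_le zero_le_one).2 fun j => by
    simp [ones_apply]
  calc A ones i ≤ ‖A ones i‖ := le_abs_self _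
    _ ≤ ‖A ones‖ := (A ones).norm_coe_le_norm i
    _ ≤ ‖A‖ * ‖ones‖ := A.le_opNorm _
    _ ≤ ‖A‖ := mul_le_of_le_one_right (norm_nonneg A) h1

/-- The Neumann series of a positive operator of norm less than one is a positive inverse. -/
theorem OpPos.exists_inverse_one_sub {A : Linf →L[ℝ] Linf} (hA : OpPos A) (h : ‖A‖ < 1) :
    ∃ B : Linf →L[ℝ] Linf, OpPos B ∧ (1 - A) * B = 1 ∧ B * (1 - A) = 1 :=
  ⟨∑' n : ℕ, A ^ n, OpPos.tsum hA.pow (summable_geometric_of_norm_lt_one (K := Linf →L[ℝ] Linf) h),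
    mul_neg_geom_series A h, geom_series_mul_neg A h⟩

theorem opNorm_mul_le {A0 A1 G B : Linf →L[ℝ] Linf} (hA0 : OpPos A0) (hA1 : OpPos A1)
    (hG : OpPos G) (hG1 : G ones = ones) (hB : OpPos B) (hl : B * (1 - A0) = 1) {c : ℝ}
    (hc1 : c ≤ 1) (hle : ∀ i, A0 ones i + 2 * A1 ones i ≤ c) :
    ‖B * (A1 + A1 * G)‖ ≤ c := by
  refine (hB.mul (hA1.add (hA1.mul hG))).opNorm_le fun i => ?_
  have hBc : B (c • (1 - A0) ones) = c • ones := by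
    rw [map_smul]
    exact congrArg (fun T : Linf →L[ℝ] Linf => c • T ones) hl
  have key := hB.mono (x := (A1 + A1 * G) ones) (y := c • (1 - A0) ones) (fun j => by
    have h0 := hA0 ones vnonneg_ones j
    have h1 : c * A0 ones j ≤ A0 ones j :=
      mul_le_of_le_one_left h0 hc1
    simp [hG1, ones_apply]
    linarith [hle j]) i
  rw [hBc] at key
  simpa [ones_apply] using key

/-- I - A₀ is invertible and ‖H₂‖ ≤ ‖H₁‖ ≤ σ, where H₁ = A₀ + A₁ + A₁G and
H₂ = (I - A₀)⁻¹(A₁ + A₁G). -/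
theorem stmt11
    (Am1 A0 A1 G : Linf →L[ℝ] Linf)
    (hAm1 : OpPos Am1) (hA0 : OpPos A0) (hA1 : OpPos A1) (hG : OpPos G)
    (hstoch : (Am1 + A0 + A1) ones = ones)
    (heq : A1 * G ^ 2 + A0 * G + Am1 = G)
    (hG1 : G ones = ones)
    (σ : ℝ) (hσ : σ < 1)
    (hgap : ∀ i, 1 - σ ≤ ((Am1 - A1) ones) i) :
    ∃ B : Linf →L[ℝ] Linf, (1 - A0) * B = 1 ∧ B * (1 - A0) = 1 ∧
      ‖B * (A1 + A1 * G)‖ ≤ ‖A0 + A1 + A1 * G‖ ∧ ‖A0 + A1 + A1 * G‖ ≤ σ := by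
  have hH1 : OpPos (A0 + A1 + A1 * G) := (hA0.add hA1).add (hA1.mul hG)
  have hval (i : ℕ) : (A0 + A1 + A1 * G) ones i = A0 ones i + 2 * A1 ones i := by
    simp [hG1]
    ring
  have hst (i : ℕ) : Am1 ones i + A0 ones i + A1 ones i = 1 :=
    congrArg (fun x : Linf => x i) hstoch
  have hσ1 : ‖A0 + A1 + A1 * G‖ ≤ σ := hH1.opNorm_le fun i => by
    have h1 : 1 - σ ≤ Am1 ones i - A1 ones i := hgap i
    linarith [hval i, hst i]
  have hle (i : ℕ) : A0 ones i + 2 * A1 ones i ≤ ‖A0 + A1 + A1 * G‖ :=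
    (hval i).symm.trans_le (apply_ones_le_opNorm (A0 + A1 + A1 * G) i)
  have hA0n : ‖A0‖ < 1 := (hA0.opNorm_le (c := ‖A0 + A1 + A1 * G‖) fun i => by
    linarith [hle i, hA1 ones vnonneg_ones i]).trans_lt (hσ1.trans_lt hσ)
  obtain ⟨B, hB, hr, hl⟩ := hA0.exists_inverse_one_sub hA0n
  exact ⟨B, hr, hl, opNorm_mul_le hA0 hA1 hG hG1 hB hl (hσ1.trans hσ.le) hle, hσ1⟩
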